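/- arXiv:2001.01304 — 2 statements merged into one kernel-verified Lean document; each statement's English description precedes it below -/
import Mathlib

section
/- Let A1, A2, B be real symmetric n×n matrices such that: A1 is positive semidefinite; A2 is positive semidefinite, positive definite on ker A1, and A2 x = 0 for every x ∈ (ker A1)ᗮ; B is positive definite and maps ker A1 into ker A1. Fix α > 0. Then a real number λ is an eigenvalue of the pencil (A1 + αA2, B) if and only if either there exists v ≠ 0 with v ∈ (ker A1)ᗮ and A1 v = λ B v, or there exists w ≠ 0 with w ∈ ker A1 and α A2 w = λ B w. In other words, the spectrum of (A1 + αA2, B) consists exactly of the eigenvalues μ of (A1, B) with eigenvectors in (ker A1)ᗮ, which are independent of α, together with the numbers αν where ν is an eigenvalue of (A2, B) with eigenvector in ker A1. -/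
open Matrix

/-- Orthogonal decomposition along the kernel of a matrix, in terms of the dot product. -/
lemma exists_add_mulVec_eq_zero_dotProduct_eq_zero {m n : Type*} [Fintype m] [Fintype n]
    (A : Matrix m n ℝ) (x : n → ℝ) :
    ∃ w v : n → ℝ, x = w + v ∧ A.mulVec w = 0 ∧
      ∀ y : n → ℝ, A.mulVec y = 0 → v ⬝ᵥ y = 0 := by
  let K : Submodule ℝ (EuclideanSpace ℝ n) :=
    (LinearMap.ker A.mulVecLin).comap (WithLp.linearEquiv 2 ℝ (n → ℝ)).toLinearMap
  obtain ⟨w, hw, v, hv, h⟩ := K.exists_add_mem_mem_orthogonal (WithLp.toLp 2 x)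
  refine ⟨w.ofLp, v.ofLp, congrArg WithLp.ofLp h, hw, fun y hy => ?_⟩
  have hvy := hv (WithLp.toLp 2 y) hy
  rw [EuclideanSpace.inner_eq_star_dotProduct] at hvy
  simpa using hvy

lemma Matrix.IsSymm.dotProduct_mulVec_comm {n R : Type*} [Fintype n] [CommSemiring R]
    {A : Matrix n n R} (hA : A.IsSymm) (x y : n → R) :
    x ⬝ᵥ A.mulVec y = A.mulVec x ⬝ᵥ y := by
  rw [dotProduct_mulVec, ← mulVec_transpose, hA.eq]

/-- A vector orthogonal both to the kernel of a matrix and to the orthogonal complement of that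
kernel is zero. -/
lemma eq_zero_of_dotProduct_ker_of_dotProduct_perp {m n : Type*} [Fintype m] [Fintype n]
    (A : Matrix m n ℝ) {u : n → ℝ} (hker : ∀ y : n → ℝ, A.mulVec y = 0 → u ⬝ᵥ y = 0)
    (hperp : ∀ z : n → ℝ, (∀ y : n → ℝ, A.mulVec y = 0 → z ⬝ᵥ y = 0) → u ⬝ᵥ z = 0) :
    u = 0 := by
  obtain ⟨k, p, hu, hk, hp⟩ := exists_add_mulVec_eq_zero_dotProduct_eq_zero A u
  rw [← dotProduct_self_eq_zero]
  nth_rewrite 2 [hu]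
  rw [dotProduct_add, hker k hk, hperp p hp, add_zero]

/-- Case 1: with `A1` symmetric PSD, `A2` symmetric PSD, positive definite on `ker A1`
and vanishing on `(ker A1)ᗮ`, and `B` symmetric positive definite mapping `ker A1` into
`ker A1`, for any fixed `α > 0` the spectrum of the pencil `(A1 + α A2, B)` consists
exactly of the eigenvalues of `(A1, B)` with eigenvectors in `(ker A1)ᗮ` together with
`α` times the eigenvalues of `(A2, B)` with eigenvectors in `ker A1`. -/
theorem spectrum_pencil_case1
    (n : ℕ) (A1 A2 B : Matrix (Fin n) (Fin n) ℝ)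
    (hA1 : A1.PosSemidef)
    (hA2 : A2.PosSemidef)
    (hA2ker : ∀ x : Fin n → ℝ, A1.mulVec x = 0 → x ≠ 0 → 0 < x ⬝ᵥ A2.mulVec x)
    (hA2perp : ∀ x : Fin n → ℝ, (∀ y : Fin n → ℝ, A1.mulVec y = 0 → x ⬝ᵥ y = 0) →
      A2.mulVec x = 0)
    (hB : B.PosDef)
    (hBker : ∀ x : Fin n → ℝ, A1.mulVec x = 0 → A1.mulVec (B.mulVec x) = 0)
    (α : ℝ) (hα : 0 < α) (lam : ℝ) :
    (∃ x : Fin n → ℝ, x ≠ 0 ∧ (A1 + α • A2).mulVec x = lam • B.mulVec x) ↔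
    ((∃ v : Fin n → ℝ, v ≠ 0 ∧ (∀ y : Fin n → ℝ, A1.mulVec y = 0 → v ⬝ᵥ y = 0) ∧
        A1.mulVec v = lam • B.mulVec v) ∨
      (∃ w : Fin n → ℝ, w ≠ 0 ∧ A1.mulVec w = 0 ∧
        α • A2.mulVec w = lam • B.mulVec w)) := by
  have sA1 : A1.IsSymm := by simpa [IsHermitian, IsSymm] using hA1.isHermitian
  have sA2 : A2.IsSymm := by simpa [IsHermitian, IsSymm] using hA2.isHermitian
  have sB : B.IsSymm := by simpa [IsHermitian, IsSymm] using hB.isHermitian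
  constructor
  · rintro ⟨x, hx0, hx⟩
    obtain ⟨w, v, rfl, hw, hv⟩ := exists_add_mulVec_eq_zero_dotProduct_eq_zero A1 x
    have hsplit : α • A2.mulVec w - lam • B.mulVec w = lam • B.mulVec v - A1.mulVec v := by
      rw [add_mulVec, smul_mulVec, mulVec_add, mulVec_add, mulVec_add, hw, hA2perp v hv,
        zero_add, add_zero, smul_add] at hx
      rw [sub_eq_sub_iff_add_eq_add, add_comm, hx, add_comm]
    have hzero : α • A2.mulVec w - lam • B.mulVec w = 0 := by
      refine eq_zero_of_dotProduct_ker_of_dotProduct_perp A1 (fun y hy => ?_) (fun z hz => ?_)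
      · rw [hsplit, sub_dotProduct, smul_dotProduct, ← sB.dotProduct_mulVec_comm,
          ← sA1.dotProduct_mulVec_comm, hv _ (hBker y hy), hy]
        simp
      · rw [sub_dotProduct, smul_dotProduct, smul_dotProduct, ← sA2.dotProduct_mulVec_comm,
          hA2perp z hz, dotProduct_comm (B.mulVec w), hz _ (hBker w hw)]
        simp
    by_cases hw0 : w = 0
    · refine Or.inl ⟨v, by simpa [hw0] using hx0, hv, ?_⟩
      exact (sub_eq_zero.mp (hsplit.symm.trans hzero)).symm
    · exact Or.inr ⟨w, hw0, hw, sub_eq_zero.mp hzero⟩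
  · rintro (⟨v, hv0, hv, h⟩ | ⟨w, hw0, hw, h⟩)
    · exact ⟨v, hv0, by rw [add_mulVec, smul_mulVec, hA2perp v hv, smul_zero, add_zero, h]⟩
    · exact ⟨w, hw0, by rw [add_mulVec, smul_mulVec, hw, zero_add, h]⟩
end

section
/- Let B1, B2, A be real symmetric n×n matrices such that: B1 is positive semidefinite; B2 is positive semidefinite, positive definite on ker B1, and B2 x = 0 for every x ∈ (ker B1)ᗮ; A is positive definite and maps ker B1 into ker B1. Fix β > 0. Then a real number λ is an eigenvalue of the pencil (A, B1 + βB2) if and only if λ > 0 and either there exists r ≠ 0 with r ∈ (ker B1)ᗮ and A r = λ B1 r, or there exists s ≠ 0 with s ∈ ker B1 and A s = λβ B2 s. In other words, the eigenvalues of (A, B1 + βB2) are the reciprocals 1/ζ of the nonzero eigenvalues ζ of (B1, A) with eigenvectors in (ker B1)ᗮ, which are independent of β, together with the numbers 1/(βξ) where ξ is an eigenvalue of (B2, A) with eigenvector in ker B1. -/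
open Matrix

/-- Every vector is the sum of one orthogonal to the kernel of a matrix and one in it. -/
theorem exists_add_orthogonal_ker {n : ℕ} (B : Matrix (Fin n) (Fin n) ℝ) (x : Fin n → ℝ) :
    ∃ r s : Fin n → ℝ, x = r + s ∧ (∀ y : Fin n → ℝ, B.mulVec y = 0 → r ⬝ᵥ y = 0) ∧
      B.mulVec s = 0 := by
  let K : Submodule ℝ (EuclideanSpace ℝ (Fin n)) := LinearMap.ker (Matrix.toEuclideanLin B)
  have mem_K (v : EuclideanSpace ℝ (Fin n)) : v ∈ K ↔ B.mulVec v.ofLp = 0 := by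
    simp [K, Matrix.toLpLin_apply]
  obtain ⟨s, hs, r, hr, hx⟩ := K.exists_add_mem_mem_orthogonal (WithLp.toLp 2 x)
  refine ⟨r.ofLp, s.ofLp, ?_, fun y hy => ?_, (mem_K s).1 hs⟩
  · rw [add_comm, ← WithLp.ofLp_add, ← hx]
  · have h := K.mem_orthogonal r |>.1 hr (WithLp.toLp 2 y) ((mem_K _).2 hy)
    simpa [EuclideanSpace.inner_eq_star_dotProduct] using h

/-- A real Hermitian matrix moves across the dot product. -/
theorem Matrix.IsHermitian.mulVec_dotProduct_comm {ι : Type*} [Fintype ι] {M : Matrix ι ι ℝ}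
    (hM : M.IsHermitian) (v w : ι → ℝ) : M.mulVec v ⬝ᵥ w = v ⬝ᵥ M.mulVec w := by
  have hT : Mᵀ = M := by simpa using hM.eq
  rw [dotProduct_mulVec, ← mulVec_transpose, hT]

/-- An eigenvalue of a pencil of a positive definite and a positive semidefinite matrix
is positive. -/
theorem Matrix.PosDef.pencil_eigenvalue_pos {ι : Type*} [Fintype ι] {A B : Matrix ι ι ℝ}
    (hA : A.PosDef) (hB : B.PosSemidef) {lam : ℝ} {x : ι → ℝ} (hx : x ≠ 0)
    (h : A.mulVec x = lam • B.mulVec x) : 0 < lam := by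
  have hAx : 0 < x ⬝ᵥ A.mulVec x := by simpa using hA.dotProduct_mulVec_pos hx
  have hBx : 0 ≤ x ⬝ᵥ B.mulVec x := by simpa using hB.dotProduct_mulVec_nonneg x
  rw [h, dotProduct_smul, smul_eq_mul] at hAx
  exact pos_of_mul_pos_left hAx hBx

/-- Case 2: with `B1` symmetric PSD, `B2` symmetric PSD, positive definite on `ker B1`
and vanishing on `(ker B1)ᗮ`, and `A` symmetric positive definite mapping `ker B1` into
`ker B1`, for any fixed `β > 0` the eigenvalues of the pencil `(A, B1 + β B2)` are
exactly the positive numbers `λ` such that either `A r = λ B1 r` for some nonzero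
`r ∈ (ker B1)ᗮ`, or `A s = λ β B2 s` for some nonzero `s ∈ ker B1`. -/
theorem spectrum_pencil_case2
    (n : ℕ) (B1 B2 A : Matrix (Fin n) (Fin n) ℝ)
    (hB1 : B1.PosSemidef)
    (hB2 : B2.PosSemidef)
    (hB2ker : ∀ x : Fin n → ℝ, B1.mulVec x = 0 → x ≠ 0 → 0 < x ⬝ᵥ B2.mulVec x)
    (hB2perp : ∀ x : Fin n → ℝ, (∀ y : Fin n → ℝ, B1.mulVec y = 0 → x ⬝ᵥ y = 0) →
      B2.mulVec x = 0)
    (hA : A.PosDef)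
    (hAker : ∀ x : Fin n → ℝ, B1.mulVec x = 0 → B1.mulVec (A.mulVec x) = 0)
    (β : ℝ) (hβ : 0 < β) (lam : ℝ) :
    (∃ x : Fin n → ℝ, x ≠ 0 ∧ A.mulVec x = lam • (B1 + β • B2).mulVec x) ↔
    (0 < lam ∧
      ((∃ r : Fin n → ℝ, r ≠ 0 ∧ (∀ y : Fin n → ℝ, B1.mulVec y = 0 → r ⬝ᵥ y = 0) ∧
          A.mulVec r = lam • B1.mulVec r) ∨
        (∃ s : Fin n → ℝ, s ≠ 0 ∧ B1.mulVec s = 0 ∧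
          A.mulVec s = (lam * β) • B2.mulVec s))) := by
  constructor
  · rintro ⟨x, hx, h⟩
    refine ⟨hA.pencil_eigenvalue_pos (hB1.add (hB2.smul hβ.le)) hx h, ?_⟩
    obtain ⟨r, s, rfl, hr, hs⟩ := exists_add_orthogonal_ker B1 x
    have hsplit : A.mulVec r - lam • B1.mulVec r = (lam * β) • B2.mulVec s - A.mulVec s := by
      simp only [mulVec_add, add_mulVec, smul_mulVec, hs, hB2perp r hr, smul_add, smul_zero,
        zero_add, add_zero, smul_smul] at h
      rw [sub_eq_sub_iff_add_eq_add, h, add_comm]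
    have hperp : ∀ y : Fin n → ℝ, B1.mulVec y = 0 →
        (A.mulVec r - lam • B1.mulVec r) ⬝ᵥ y = 0 := fun y hy => by
      rw [sub_dotProduct, smul_dotProduct, hA.isHermitian.mulVec_dotProduct_comm,
        hB1.isHermitian.mulVec_dotProduct_comm, hy, hr _ (hAker y hy)]
      simp
    have hzero : A.mulVec r - lam • B1.mulVec r = 0 := by
      rw [← dotProduct_self_eq_zero]
      conv_lhs => rw [hsplit, dotProduct_sub, ← hsplit]
      rw [hperp _ (hAker s hs), dotProduct_smul, ← hB2.isHermitian.mulVec_dotProduct_comm,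
        hB2perp _ hperp]
      simp
    by_cases hr0 : r = 0
    · refine Or.inr ⟨s, by simpa [hr0] using hx, hs, ?_⟩
      exact (sub_eq_zero.1 (hsplit.symm.trans hzero)).symm
    · exact Or.inl ⟨r, hr0, hr, sub_eq_zero.1 hzero⟩
  · rintro ⟨-, ⟨r, hr0, hr, h⟩ | ⟨s, hs0, hs, h⟩⟩
    · exact ⟨r, hr0, by simp [add_mulVec, smul_mulVec, hB2perp r hr, h]⟩
    · exact ⟨s, hs0, by simp [add_mulVec, smul_mulVec, hs, h, smul_smul]⟩
end
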